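/- Define h(λ) = (1/2)·log(1 + 1/max(λ-1, 1)) - 1/(12λ+1) for λ > 0. Then for every λ > 1: (a) H_SH(λ) ≥ (1/2)·log(2πλ) - h(λ); (b) for every α > 0 with α ≠ 1, H_R(α,λ) ≥ (1/2)·log(2πλ) - h(λ); (c) for every α > 0, H_GR(α,λ) ≥ (1/2)·log(2πλ) - h(λ); (d) for all α, β > 0 with α ≠ β, H_GR(α,β,λ) ≥ (1/2)·log(2πλ) - h(λ). -/

import Mathlib

open Real Filter Topology

/-- The Poisson probabilities `p_i(λ) = e^{-λ} λ^i / i!`. -/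
noncomputable def poissonP (l : ℝ) (i : ℕ) : ℝ :=
  Real.exp (-l) * l ^ i / (Nat.factorial i)

/-- `ψ(α,λ) = ∑_{i=0}^∞ (p_i(λ))^α`. -/
noncomputable def psiPoisson (α l : ℝ) : ℝ :=
  ∑' i, (poissonP l i) ^ α

open Stirling in
/-- The lower half of Robbins' stepwise bound for the Stirling sequence. -/
theorem le_log_stirlingSeq_sub_log_stirlingSeq_succ (m : ℕ) :
    1 / (12 * ((m : ℝ) + 1) + 1) - 1 / (12 * ((m : ℝ) + 2) + 1) ≤
      Real.log (stirlingSeq (m + 1)) - Real.log (stirlingSeq (m + 2)) := by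
  set x : ℝ := (1 / (2 * ((m + 1 : ℕ) : ℝ) + 1)) ^ 2 with hx
  have hx0 : 0 ≤ x := sq_nonneg _
  have hx1 : x / 3 < 1 := by
    have : x ≤ 1 := by
      rw [hx]
      apply pow_le_one₀ (by positivity)
      rw [div_le_one (by positivity)]
      push_cast
      have : (0 : ℝ) ≤ m := m.cast_nonneg
      linarith
    linarith
  have hgeo : HasSum (fun k : ℕ => (x / 3) ^ (k + 1)) (x / 3 * (1 - x / 3)⁻¹) := by
    simp_rw [pow_succ']
    exact (hasSum_geometric_of_lt_one (by positivity) hx1).mul_left _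
  have hle := hasSum_le (fun k => ?_) hgeo (log_stirlingSeq_sdiff_hasSum m)
  · refine le_trans ?_ hle
    have hm : (0 : ℝ) ≤ m := m.cast_nonneg
    have hval : x / 3 * (1 - x / 3)⁻¹ = 1 / (3 * (2 * ((m : ℝ) + 1) + 1) ^ 2 - 1) := by
      have h1 : 3 * (2 * ((m : ℝ) + 1) + 1) ^ 2 - 1 ≠ 0 := by nlinarith
      have h2 : 1 - x / 3 ≠ 0 := by linarith
      rw [← div_eq_mul_inv, div_eq_div_iff h2 h1, hx]
      push_cast
      field_simp
    rw [hval, div_sub_div _ _ (by positivity) (by positivity),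
      div_le_div_iff₀ (by positivity) (by nlinarith)]
    nlinarith
  · have h3 : (2 * ((k + 1 : ℕ) : ℝ) + 1) ≤ 3 ^ (k + 1) := by
      have := one_add_mul_le_pow (a := (2 : ℝ)) (by norm_num) (k + 1)
      norm_num at this ⊢
      linarith
    rw [div_pow, div_eq_inv_mul, ← one_div]
    gcongr

open Stirling in
/-- The lower half of Robbins' bound for the factorial. -/
theorem robbins_le_log_factorial {n : ℕ} (hn : 1 ≤ n) :
    n * Real.log n - n + Real.log n / 2 + Real.log (2 * π) / 2 + 1 / (12 * (n : ℝ) + 1) ≤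
      Real.log n.factorial := by
  have hanti : Antitone fun m : ℕ =>
      Real.log (stirlingSeq (m + 1)) - 1 / (12 * ((m : ℝ) + 1) + 1) := by
    refine antitone_nat_of_succ_le fun m => ?_
    have := le_log_stirlingSeq_sub_log_stirlingSeq_succ m
    push_cast
    rw [show (m : ℝ) + 1 + 1 = m + 2 by ring]
    linarith
  have hlim : Tendsto (fun m : ℕ =>
      Real.log (stirlingSeq (m + 1)) - 1 / (12 * ((m : ℝ) + 1) + 1)) atTop
      (𝓝 (Real.log √π - 0)) := by
    refine Tendsto.sub ?_ ?_
    · exact ((tendsto_add_atTop_iff_nat 1).2 tendsto_stirlingSeq_sqrt_pi).log (by positivity)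
    · refine tendsto_const_nhds.div_atTop ?_
      refine tendsto_atTop_add_const_right _ _ (Tendsto.const_mul_atTop (by norm_num) ?_)
      exact tendsto_atTop_add_const_right _ _ tendsto_natCast_atTop_atTop
  obtain ⟨m, rfl⟩ := Nat.exists_eq_add_of_le' hn
  have h := hanti.le_of_tendsto hlim m
  have hm : ((m + 1 : ℕ) : ℝ) ≠ 0 := by positivity
  simp only [log_stirlingSeq_formula, Real.log_sqrt pi_pos.le,
    Real.log_mul two_ne_zero hm, Real.log_div hm (Real.exp_ne_zero 1), Real.log_exp] at h
  rw [Real.log_mul two_ne_zero pi_pos.ne']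
  push_cast at h ⊢
  linarith

theorem poissonP_pos {l : ℝ} (hl : 0 < l) (i : ℕ) : 0 < poissonP l i := by
  unfold poissonP
  positivity

theorem poissonP_succ (l : ℝ) (i : ℕ) :
    poissonP l (i + 1) = poissonP l i * (l / (i + 1)) := by
  unfold poissonP
  rw [Nat.factorial_succ]
  push_cast
  field_simp
  ring

theorem hasSum_poissonP (l : ℝ) : HasSum (poissonP l) 1 := by
  have h := (NormedSpace.expSeries_div_hasSum_exp l).mul_left (Real.exp (-l))
  rw [← Real.exp_eq_exp_ℝ, ← Real.exp_add, neg_add_cancel, Real.exp_zero] at h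
  simp only [← mul_div_assoc] at h
  exact h

theorem poissonP_le_one {l : ℝ} (hl : 0 < l) (i : ℕ) : poissonP l i ≤ 1 :=
  le_hasSum (hasSum_poissonP l) i fun j _ => (poissonP_pos hl j).le

/-- The floor of `l` is a mode of the Poisson distribution. -/
theorem poissonP_le_poissonP_floor {l : ℝ} (hl : 0 < l) (i : ℕ) :
    poissonP l i ≤ poissonP l ⌊l⌋₊ := by
  rcases le_total i ⌊l⌋₊ with h | h
  · refine Nat.decreasingInduction' (P := fun j => poissonP l j ≤ poissonP l ⌊l⌋₊)
      (fun k hk _ ih => le_trans ?_ ih) h le_rfl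
    rw [poissonP_succ]
    refine le_mul_of_one_le_right (poissonP_pos hl k).le ?_
    rw [one_le_div (by positivity)]
    exact_mod_cast (Nat.le_floor_iff hl.le).1 (Nat.succ_le_of_lt hk)
  · induction i, h using Nat.le_induction with
    | base => exact le_rfl
    | succ k hk ih =>
      refine le_trans ?_ ih
      rw [poissonP_succ]
      refine mul_le_of_le_one_right (poissonP_pos hl k).le ?_
      rw [div_le_one (by positivity)]
      exact_mod_cast (Nat.lt_of_floor_lt (Nat.lt_succ_of_le hk)).le

/-- A uniform bound on the logarithms of the Poisson probabilities, i.e. on the min-entropy. -/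
theorem log_poissonP_le {l : ℝ} (hl : 1 < l) (i : ℕ) :
    Real.log (poissonP l i) ≤ -((1 / 2) * Real.log (2 * Real.pi * l) -
      ((1 / 2) * Real.log (1 + 1 / max (l - 1) 1) - 1 / (12 * l + 1))) := by
  have hl0 : 0 < l := one_pos.trans hl
  refine (Real.log_le_log (poissonP_pos hl0 i) (poissonP_le_poissonP_floor hl0 i)).trans ?_
  have hn : 1 ≤ ⌊l⌋₊ := (Nat.one_le_floor_iff l).2 hl.le
  have hnl : (⌊l⌋₊ : ℝ) ≤ l := Nat.floor_le hl0.le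
  have hln : l < ⌊l⌋₊ + 1 := Nat.lt_floor_add_one l
  generalize ⌊l⌋₊ = n at hn hnl hln
  have hn1 : (1 : ℝ) ≤ n := by exact_mod_cast hn
  have hn0 : (0 : ℝ) < n := by linarith
  have hlog : Real.log (poissonP l n) = -l + n * Real.log l - Real.log n.factorial := by
    rw [poissonP, Real.log_div (by positivity) (by positivity),
      Real.log_mul (by positivity) (by positivity), Real.log_exp, Real.log_pow]
  have hrob := robbins_le_log_factorial hn
  have hpow : n * Real.log l - n * Real.log n ≤ l - n := by
    have := Real.log_le_sub_one_of_pos (div_pos hl0 hn0)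
    rw [Real.log_div hl0.ne' hn0.ne'] at this
    have h := mul_le_mul_of_nonneg_left this hn0.le
    have he : n * (l / n - 1) = l - n := by field_simp
    linarith
  have hinv : 1 / (12 * l + 1) ≤ 1 / (12 * (n : ℝ) + 1) := by gcongr
  have hM : max (l - 1) 1 ≤ n := max_le (by linarith) hn1
  have hM0 : 0 < max (l - 1) 1 := lt_max_of_lt_right one_pos
  have hratio : l / n ≤ 1 + 1 / max (l - 1) 1 := by
    have h1 : 1 / (n : ℝ) ≤ 1 / max (l - 1) 1 := one_div_le_one_div_of_le hM0 hM
    have h2 : l / n ≤ 1 + 1 / n := by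
      rw [div_le_iff₀ hn0]
      field_simp
      linarith
    linarith
  have hlr := Real.log_le_log (div_pos hl0 hn0) hratio
  rw [Real.log_div hl0.ne' hn0.ne'] at hlr
  rw [Real.log_mul (by positivity) hl0.ne']
  linarith

theorem summable_poissonP_rpow {l : ℝ} (hl : 0 < l) {α : ℝ} (hα : 0 < α) :
    Summable fun i => poissonP l i ^ α := by
  refine summable_of_ratio_test_tendsto_lt_one zero_lt_one
    (.of_forall fun i => (Real.rpow_pos_of_pos (poissonP_pos hl i) α).ne') ?_
  have hlim : Tendsto (fun i : ℕ => (l / ((i : ℝ) + 1)) ^ α) atTop (𝓝 0) := by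
    have h : Tendsto (fun i : ℕ => l / ((i : ℝ) + 1)) atTop (𝓝 0) :=
      tendsto_const_nhds.div_atTop
        (tendsto_atTop_add_const_right _ _ tendsto_natCast_atTop_atTop)
    simpa [Real.zero_rpow hα.ne'] using h.rpow_const (.inr hα.le)
  refine hlim.congr fun i => ?_
  have hp := poissonP_pos hl i
  rw [Real.norm_of_nonneg (Real.rpow_nonneg (poissonP_pos hl _).le α),
    Real.norm_of_nonneg (Real.rpow_nonneg hp.le α), poissonP_succ,
    Real.mul_rpow hp.le (by positivity)]
  exact (mul_div_cancel_left₀ _ (Real.rpow_pos_of_pos hp α).ne').symm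

theorem psiPoisson_pos {l : ℝ} (hl : 0 < l) {α : ℝ} (hα : 0 < α) : 0 < psiPoisson α l :=
  (summable_poissonP_rpow hl hα).tsum_pos
    (fun i => (Real.rpow_pos_of_pos (poissonP_pos hl i) α).le) 0
    (Real.rpow_pos_of_pos (poissonP_pos hl 0) α)

theorem psiPoisson_one (l : ℝ) : psiPoisson 1 l = 1 := by
  simp [psiPoisson, (hasSum_poissonP l).tsum_eq]

theorem summable_poissonP_rpow_mul_log {l : ℝ} (hl : 0 < l) {α : ℝ} (hα : 0 < α) :
    Summable fun i => poissonP l i ^ α * Real.log (poissonP l i) := by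
  refine Summable.of_norm_bounded
    ((summable_poissonP_rpow hl (half_pos hα)).mul_right (1 / (α / 2))) fun i => ?_
  have hp := poissonP_pos hl i
  have h := Real.abs_log_mul_self_rpow_lt _ _ hp (poissonP_le_one hl i) (half_pos hα)
  have he : poissonP l i ^ α * Real.log (poissonP l i) =
      poissonP l i ^ (α / 2) * (Real.log (poissonP l i) * poissonP l i ^ (α / 2)) := by
    rw [mul_left_comm, ← Real.rpow_add hp, add_halves, mul_comm]
  rw [he, norm_mul, Real.norm_of_nonneg (Real.rpow_nonneg hp.le _)]
  exact mul_le_mul_of_nonneg_left h.le (Real.rpow_nonneg hp.le _)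

/-- A lower bound on the min-entropy bounds the one-parameter generalized Rényi entropy. -/
theorem le_generalizedRenyi_of_log_poissonP_le {l B α : ℝ} (hl : 0 < l)
    (hB : ∀ i, Real.log (poissonP l i) ≤ -B) (hα : 0 < α) :
    B ≤ -(∑' i, poissonP l i ^ α * Real.log (poissonP l i)) / psiPoisson α l := by
  rw [le_div_iff₀ (psiPoisson_pos hl hα)]
  have h : ∑' i, poissonP l i ^ α * Real.log (poissonP l i) ≤ ∑' i, poissonP l i ^ α * -B :=
    (summable_poissonP_rpow_mul_log hl hα).tsum_le_tsum
      (fun i => mul_le_mul_of_nonneg_left (hB i) (Real.rpow_nonneg (poissonP_pos hl i).le α))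
      ((summable_poissonP_rpow hl hα).mul_right _)
  rw [tsum_mul_right, ← psiPoisson] at h
  linarith

theorem log_psiPoisson_le_of_log_poissonP_le {l B α β : ℝ} (hl : 0 < l)
    (hB : ∀ i, Real.log (poissonP l i) ≤ -B) (hα : 0 < α) (hαβ : α < β) :
    Real.log (psiPoisson β l) ≤ Real.log (psiPoisson α l) - B * (β - α) := by
  have hβ := hα.trans hαβ
  have h : psiPoisson β l ≤ psiPoisson α l * Real.exp (-B * (β - α)) := by
    rw [psiPoisson, psiPoisson, ← tsum_mul_right]
    refine (summable_poissonP_rpow hl hβ).tsum_le_tsum (fun i => ?_)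
      ((summable_poissonP_rpow hl hα).mul_right _)
    have hp := poissonP_pos hl i
    rw [← add_sub_cancel α β, Real.rpow_add hp, add_sub_cancel_left]
    refine mul_le_mul_of_nonneg_left ?_ (Real.rpow_nonneg hp.le α)
    rw [Real.rpow_def_of_pos hp]
    exact Real.exp_le_exp.2 (mul_le_mul_of_nonneg_right (hB i) (sub_pos.2 hαβ).le)
  have h' := Real.log_le_log (psiPoisson_pos hl hβ) h
  rw [Real.log_mul (psiPoisson_pos hl hα).ne' (Real.exp_ne_zero _), Real.log_exp] at h'
  linarith

/-- A lower bound on the min-entropy bounds the two-parameter generalized Rényi entropy. -/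
theorem le_generalizedRenyi₂_of_log_poissonP_le {l B α β : ℝ} (hl : 0 < l)
    (hB : ∀ i, Real.log (poissonP l i) ≤ -B) (hα : 0 < α) (hβ : 0 < β) (hαβ : α ≠ β) :
    B ≤ (β - α)⁻¹ * Real.log (psiPoisson α l / psiPoisson β l) := by
  rw [Real.log_div (psiPoisson_pos hl hα).ne' (psiPoisson_pos hl hβ).ne', ← div_eq_inv_mul]
  rcases lt_or_gt_of_ne hαβ with h | h
  · rw [le_div_iff₀ (sub_pos.2 h)]
    linarith [log_psiPoisson_le_of_log_poissonP_le hl hB hα h]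
  · rw [le_div_iff_of_neg (sub_neg.2 h)]
    linarith [log_psiPoisson_le_of_log_poissonP_le hl hB hβ h]

/-- lower bounds for the Shannon, Rényi and generalized Rényi
entropies of the Poisson distribution, for λ > 1. -/
theorem poisson_entropies_lower_bound (l : ℝ) (hl : 1 < l) :
    ((-∑' i, poissonP l i * Real.log (poissonP l i)) ≥
      (1 / 2) * Real.log (2 * Real.pi * l) -
        ((1 / 2) * Real.log (1 + 1 / max (l - 1) 1) - 1 / (12 * l + 1))) ∧
    (∀ α : ℝ, 0 < α → α ≠ 1 →
      (1 - α)⁻¹ * Real.log (psiPoisson α l) ≥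
        (1 / 2) * Real.log (2 * Real.pi * l) -
          ((1 / 2) * Real.log (1 + 1 / max (l - 1) 1) - 1 / (12 * l + 1))) ∧
    (∀ α : ℝ, 0 < α →
      -(∑' i, (poissonP l i) ^ α * Real.log (poissonP l i)) / psiPoisson α l ≥
        (1 / 2) * Real.log (2 * Real.pi * l) -
          ((1 / 2) * Real.log (1 + 1 / max (l - 1) 1) - 1 / (12 * l + 1))) ∧
    (∀ α β : ℝ, 0 < α → 0 < β → α ≠ β →
      (β - α)⁻¹ * Real.log (psiPoisson α l / psiPoisson β l) ≥
        (1 / 2) * Real.log (2 * Real.pi * l) -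
          ((1 / 2) * Real.log (1 + 1 / max (l - 1) 1) - 1 / (12 * l + 1))) := by
  have hl0 : 0 < l := one_pos.trans hl
  have hB := log_poissonP_le hl
  refine ⟨?_, fun α hα h1 => ?_, fun α hα => ?_, fun α β hα hβ hαβ => ?_⟩
  · simpa [psiPoisson_one] using le_generalizedRenyi_of_log_poissonP_le hl0 hB one_pos
  · simpa only [psiPoisson_one, div_one] using
      le_generalizedRenyi₂_of_log_poissonP_le hl0 hB hα one_pos h1
  · exact le_generalizedRenyi_of_log_poissonP_le hl0 hB hα
  · exact le_generalizedRenyi₂_of_log_poissonP_le hl0 hB hα hβ hαβ
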